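/- arXiv:2603.11529 — 2 statements merged into one kernel-verified Lean document; each statement's English description precedes it below -/
import Mathlib

section
/- Let L be a loop equipped with a measurable space structure such that for each a ∈ L the left translation L_a(x) = a·x is a measurable bijection with measurable inverse. Let μ be a σ-finite measure on L quasi-invariant under all left translations, and fix a, b ∈ L such that μ and (Φ_{a,b})_*μ are mutually absolutely continuous, where Φ_{a,b} := L_a ∘ L_b ∘ L_{a·b}⁻¹. Write λ(c,x) = d((L_c)_*μ)/dμ (x) and J_Φ(a,b;x) = d((Φ_{a,b})_*μ)/dμ (x). Then for μ-almost every x ∈ L: λ(a, Φ_{a,b}(x)) · λ(b, L_a⁻¹(Φ_{a,b}(x))) = J_Φ(a,b; Φ_{a,b}(x)) · λ(a·b, x). -/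
open MeasureTheory

/-- A loop: a set with a binary operation and a two-sided identity such that
the equations `a * x = b` and `y * a = b` have unique solutions. -/
class LoopStr (L : Type*) extends Mul L, One L where
  one_mul : ∀ x : L, 1 * x = x
  mul_one : ∀ x : L, x * 1 = x
  existsUnique_mul_left : ∀ a b : L, ∃! x : L, a * x = b
  existsUnique_mul_right : ∀ a b : L, ∃! y : L, y * a = b

/-- Chain rule for the Radon-Nikodym cocycle of a composition of quasi-invariant equivalences. -/
theorem rnDeriv_map_trans_ae_eq {X : Type*} [MeasurableSpace X] (μ : Measure X) [SigmaFinite μ]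
    (S E : X ≃ᵐ X) (hS : μ.map S ≪ μ) (hE : μ.map E ≪ μ) :
    (μ.map (S.trans E)).rnDeriv μ
      =ᵐ[μ] fun y ↦ (μ.map E).rnDeriv μ y * (μ.map S).rnDeriv μ (E.symm y) := by
  have : SigmaFinite (μ.map S) := S.sigmaFinite_map
  have : SigmaFinite (μ.map E) := E.sigmaFinite_map
  have : SigmaFinite ((μ.map S).map E) := E.sigmaFinite_map
  have hmap : μ.map (S.trans E) = (μ.map S).map E :=
    (Measure.map_map E.measurable S.measurable).symm
  have hpull : ∀ᵐ y ∂(μ.map E),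
      ((μ.map S).map E).rnDeriv (μ.map E) y = (μ.map S).rnDeriv μ (E.symm y) := by
    rw [E.measurableEmbedding.ae_map_iff]
    filter_upwards [E.measurableEmbedding.rnDeriv_map (μ.map S) μ] with x hx
    simpa using hx
  rw [← Measure.withDensity_rnDeriv_eq _ _ hE,
    ae_withDensity_iff (Measure.measurable_rnDeriv _ _),
    Measure.withDensity_rnDeriv_eq _ _ hE] at hpull
  rw [hmap]
  filter_upwards [Measure.rnDeriv_mul_rnDeriv (κ := μ) (hS.map E.measurable), hpull]
    with y hy hp
  rw [← hy, Pi.mul_apply, mul_comm]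
  by_cases h0 : (μ.map E).rnDeriv μ y = 0
  · simp [h0]
  · rw [hp h0]

/-- Deviation-corrected cocycle relation, evaluated along `Φ_{a,b}`.
Here `T a` is the left translation `x ↦ a * x` as a measurable equivalence,
and `Φ_{a,b} = L_a ∘ L_b ∘ L_{a·b}⁻¹` is realized as
`((T (a*b)).symm.trans (T b)).trans (T a)`.  If `μ` is σ-finite,
quasi-invariant under all left translations, and `μ` and `(Φ_{a,b})⁎μ` are
mutually absolutely continuous, then μ-a.e.
`λ(a, Φ_{a,b} x) · λ(b, L_a⁻¹(Φ_{a,b} x)) = J_Φ(a,b; Φ_{a,b} x) · λ(a·b, x)`. -/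
theorem deviation_corrected_cocycle_along_deviation
    {L : Type*} [LoopStr L] [MeasurableSpace L]
    (T : L → L ≃ᵐ L) (hT : ∀ a x : L, T a x = a * x)
    (μ : Measure L) [SigmaFinite μ]
    (hqi : ∀ a : L, μ.map (T a) ≪ μ)
    (a b : L)
    (hΦ : μ.map (((T (a * b)).symm.trans (T b)).trans (T a)) ≪ μ)
    (hΦ' : μ ≪ μ.map (((T (a * b)).symm.trans (T b)).trans (T a))) :
    ∀ᵐ x ∂μ,
      (μ.map (T a)).rnDeriv μ ((((T (a * b)).symm.trans (T b)).trans (T a)) x)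
        * (μ.map (T b)).rnDeriv μ
            ((T a).symm ((((T (a * b)).symm.trans (T b)).trans (T a)) x))
        = (μ.map (((T (a * b)).symm.trans (T b)).trans (T a))).rnDeriv μ
              ((((T (a * b)).symm.trans (T b)).trans (T a)) x)
          * (μ.map (T (a * b))).rnDeriv μ x := by
  set Φ := ((T (a * b)).symm.trans (T b)).trans (T a)
  have hcomp : (T b).trans (T a) = (T (a * b)).trans Φ := by
    ext x
    simp [Φ]
  have hab := rnDeriv_map_trans_ae_eq μ (T b) (T a) (hqi b) (hqi a)
  have hdev := rnDeriv_map_trans_ae_eq μ (T (a * b)) Φ (hqi (a * b)) hΦ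
  rw [hcomp] at hab
  filter_upwards [ae_of_ae_map Φ.measurable.aemeasurable (hΦ.ae_le (hab.symm.trans hdev))]
    with x hx
  simpa using hx
end

section
/- Let L be a loop equipped with a measurable space structure such that for each a ∈ L both the left translation L_a(x) = a·x and the right translation R_a(x) = x·a are measurable bijections with measurable inverses. Assume L satisfies the Kunen identity ((x·y)·z)·y = x·(y·(z·y)) for all x, y, z ∈ L. Let μ be a σ-finite measure on L quasi-invariant under all left and right translations, and write λ(a,w) = d((L_a)_*μ)/dμ (w) and ρ(a,w) = d((R_a)_*μ)/dμ (w). Then for all x, y ∈ L and μ-almost every w: ρ(y,w) · λ(x·y, R_y⁻¹(w)) = λ(x,w) · λ(y, L_x⁻¹(w)) · ρ(y, L_y⁻¹(L_x⁻¹(w))). -/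
open MeasureTheory

namespace MeasureTheory.Measure

variable {α : Type*} [MeasurableSpace α] {μ κ : Measure α} [SigmaFinite μ] {e : α ≃ᵐ α}

/-- If `p` holds `μ`-almost everywhere, then `p ∘ e.symm` holds `μ`-almost everywhere on the set
where the density of `μ.map e` does not vanish. -/
theorem ae_symm_of_rnDeriv_map_ne_zero (he : μ.map e ≪ μ) {p : α → Prop} (hp : ∀ᵐ w ∂μ, p w) :
    ∀ᵐ w ∂μ, (μ.map e).rnDeriv μ w ≠ 0 → p (e.symm w) := by
  have : SigmaFinite (μ.map e) := e.sigmaFinite_map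
  rw [← ae_withDensity_iff (measurable_rnDeriv _ _), withDensity_rnDeriv_eq _ _ he,
    e.measurableEmbedding.ae_map_iff]
  simpa using hp

/-- Chain rule for the density of the pushforward of `κ` under a nonsingular transformation. -/
theorem rnDeriv_map_measurableEquiv [SigmaFinite κ] (he : μ.map e ≪ μ) (hκ : κ ≪ μ) :
    ∀ᵐ w ∂μ, (κ.map e).rnDeriv μ w = (μ.map e).rnDeriv μ w * κ.rnDeriv μ (e.symm w) := by
  have : SigmaFinite (μ.map e) := e.sigmaFinite_map
  have : SigmaFinite (κ.map e) := e.sigmaFinite_map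
  filter_upwards [rnDeriv_mul_rnDeriv (κ := μ) (hκ.map e.measurable),
    ae_symm_of_rnDeriv_map_ne_zero he (e.measurableEmbedding.rnDeriv_map κ μ)] with w hmul hcomp
  rw [← hmul, Pi.mul_apply]
  by_cases h : (μ.map e).rnDeriv μ w = 0
  · simp [h]
  · rw [← hcomp h, e.apply_symm_apply, mul_comm]

end MeasureTheory.Measure

/-- Kunen-type constraint.  Here `TL a` is the left translation `w ↦ a * w`
and `TR a` is the right translation `w ↦ w * a`, both as measurable
equivalences.  If the loop satisfies the Kunen identity
`((x·y)·z)·y = x·(y·(z·y))` (so that `R_y ∘ L_{x·y} = L_x ∘ L_y ∘ R_y`) and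
`μ` is σ-finite and quasi-invariant under all left and right translations,
then for all `x, y` and μ-a.e. `w`,
`ρ(y,w) · λ(x·y, R_y⁻¹ w) = λ(x,w) · λ(y, L_x⁻¹ w) · ρ(y, L_y⁻¹(L_x⁻¹ w))`. -/
theorem kunen_modular_constraint {L : Type*} [LoopStr L] [MeasurableSpace L]
    (TL TR : L → L ≃ᵐ L)
    (hTL : ∀ a w : L, TL a w = a * w) (hTR : ∀ a w : L, TR a w = w * a)
    (hKunen : ∀ x y z : L, ((x * y) * z) * y = x * (y * (z * y)))
    (μ : Measure L) [SigmaFinite μ]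
    (hqiL : ∀ a : L, μ.map (TL a) ≪ μ) (hqiR : ∀ a : L, μ.map (TR a) ≪ μ) :
    ∀ x y : L, ∀ᵐ w ∂μ,
      (μ.map (TR y)).rnDeriv μ w
          * (μ.map (TL (x * y))).rnDeriv μ ((TR y).symm w)
        = (μ.map (TL x)).rnDeriv μ w
          * (μ.map (TL y)).rnDeriv μ ((TL x).symm w)
          * (μ.map (TR y)).rnDeriv μ ((TL y).symm ((TL x).symm w)) := by
  intro x y
  have : SigmaFinite (μ.map (TR y)) := (TR y).sigmaFinite_map
  have : SigmaFinite (μ.map (TL (x * y))) := (TL (x * y)).sigmaFinite_map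
  have : SigmaFinite ((μ.map (TR y)).map (TL y)) := (TL y).sigmaFinite_map
  have hcomp : (μ.map (TL (x * y))).map (TR y) = ((μ.map (TR y)).map (TL y)).map (TL x) := by
    rw [Measure.map_map (TR y).measurable (TL _).measurable,
      Measure.map_map (TL y).measurable (TR y).measurable,
      Measure.map_map (TL x).measurable ((TL y).measurable.comp (TR y).measurable)]
    congr 1
    funext z
    simp [hTL, hTR, hKunen]
  have hLR : (μ.map (TR y)).map (TL y) ≪ μ :=
    ((hqiR y).map (TL y).measurable).trans (hqiL y)
  filter_upwards [Measure.rnDeriv_map_measurableEquiv (hqiR y) (hqiL (x * y)),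
    Measure.rnDeriv_map_measurableEquiv (hqiL x) hLR,
    Measure.ae_symm_of_rnDeriv_map_ne_zero (hqiL x)
      (Measure.rnDeriv_map_measurableEquiv (hqiL y) (hqiR y))] with w hleft hright hinner
  rw [← hleft, hcomp, hright]
  by_cases h : (μ.map (TL x)).rnDeriv μ w = 0
  · simp [h]
  · rw [hinner h, mul_assoc]
end
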